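/- Let n ≥ 4 and let M be an edge set of the complete graph K_n such that the subgraph K_n[M] induced by the edges of M is a path P_4 on 4 vertices. Then κ_3(K_n \ M) = n − 3. -/

import Mathlib

open SimpleGraph

/-- Trees `T 0, …, T (r-1)` are internally disjoint `S`-trees in `G`: each `T i` is a
subgraph of `G` that is a tree containing every vertex of `S`, the edge sets are pairwise
disjoint, and the vertex sets of any two distinct trees intersect exactly in `S`. -/
def IsInternallyDisjointSTrees {V : Type*} (G : SimpleGraph V) (S : Set V) {r : ℕ}
    (T : Fin r → G.Subgraph) : Prop :=
  (∀ i, S ⊆ (T i).verts ∧ (T i).coe.IsTree) ∧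
  Pairwise fun i j =>
    Disjoint (T i).edgeSet (T j).edgeSet ∧ (T i).verts ∩ (T j).verts = S

/-- The generalized `k`-connectivity `κ_k(G)`: the greatest positive integer `r` such that
for every set `S` of `k` vertices there are `r` internally disjoint `S`-trees in `G`. -/
noncomputable def genConn {V : Type*} (G : SimpleGraph V) (k : ℕ) : ℕ :=
  sSup {r : ℕ | 0 < r ∧ ∀ S : Finset V, S.card = k →
    ∃ T : Fin r → G.Subgraph, IsInternallyDisjointSTrees G (↑S) T}

/-- `M` forms a path on 4 vertices `a - b - c - d`. -/
def IsP4Edges {V : Type*} (M : Set (Sym2 V)) : Prop :=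
  ∃ a b c d : V, [a, b, c, d].Nodup ∧ M = {s(a, b), s(b, c), s(c, d)}

/-- `M` forms the vertex-disjoint union of a path on 3 vertices `a - b - c`
and a single edge `d - e`. -/
def IsP3UnionP2Edges {V : Type*} (M : Set (Sym2 V)) : Prop :=
  ∃ a b c d e : V, [a, b, c, d, e].Nodup ∧ M = {s(a, b), s(b, c), s(d, e)}

/-- `M` forms the vertex-disjoint union of a triangle on `a, b, c`
and a single edge `d - e`. -/
def IsC3UnionP2Edges {V : Type*} (M : Set (Sym2 V)) : Prop :=
  ∃ a b c d e : V, [a, b, c, d, e].Nodup ∧ M = {s(a, b), s(b, c), s(a, c), s(d, e)}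

/-- `M` is a matching: no two distinct members of `M` share a vertex. -/
def IsMatchingEdges {V : Type*} (M : Set (Sym2 V)) : Prop :=
  M.Pairwise fun e f => ∀ v : V, v ∈ e → v ∉ f

/-- A connected subgraph has a spanning tree. -/
lemma SimpleGraph.Subgraph.exists_isTree_le {V : Type*} [Finite V] {G : SimpleGraph V}
    (H : G.Subgraph) (hH : H.coe.Connected) :
    ∃ T : G.Subgraph, T ≤ H ∧ T.verts = H.verts ∧ T.coe.IsTree := by
  obtain ⟨K, hKH, hK⟩ := hH.exists_isTree_le
  refine ⟨{ verts := H.verts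
            Adj := fun u w => ∃ hu hw, K.Adj ⟨u, hu⟩ ⟨w, hw⟩
            adj_sub := fun ⟨_, _, h⟩ => H.adj_sub (hKH h)
            edge_vert := fun ⟨hu, _, _⟩ => hu
            symm := ⟨fun _ _ ⟨hu, hw, h⟩ => ⟨hw, hu, h.symm⟩⟩ }, ⟨le_rfl, ?_⟩, rfl, ?_⟩
  · rintro u w ⟨_, _, h⟩
    exact hKH h
  · convert hK using 1
    ext u w
    exact ⟨fun ⟨_, _, h⟩ => h, fun h => ⟨u.2, w.2, h⟩⟩

/-- The star from `v` to the vertices of `S`, together with the edges inside `S` that `o`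
assigns to `v`. -/
def ownedStar {V : Type*} (G : SimpleGraph V) (S : Set V) (o : Sym2 V → V) (v : V) :
    G.Subgraph where
  verts := insert v S
  Adj u w := G.Adj u w ∧ ((u = v ∧ w ∈ S) ∨ (u ∈ S ∧ w = v) ∨ (u ∈ S ∧ w ∈ S ∧ o s(u, w) = v))
  adj_sub h := h.1
  edge_vert := by
    rintro u w ⟨_, h⟩
    simp only [Set.mem_insert_iff]
    tauto
  symm := ⟨by
    rintro u w ⟨h, h'⟩
    rw [Sym2.eq_swap] at h'
    exact ⟨h.symm, by tauto⟩⟩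

/-- The vertex `x` can be joined to `v` by a path of length at most three whose inner vertices
are in `S` and whose edges inside `S` are assigned to `v`. -/
def OwnedReach {V : Type*} (G : SimpleGraph V) (S : Set V) (o : Sym2 V → V) (v x : V) : Prop :=
  G.Adj x v ∨ ∃ y ∈ S, G.Adj x y ∧ o s(x, y) = v ∧
    (G.Adj y v ∨ ∃ z ∈ S, G.Adj y z ∧ o s(y, z) = v ∧ G.Adj z v)

lemma ownedStar_connected {V : Type*} (G : SimpleGraph V) (S : Set V) (o : Sym2 V → V) (v : V)
    (h : ∀ x ∈ S, OwnedReach G S o v x) : (ownedStar G S o v).coe.Connected := by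
  have hv : v ∈ (ownedStar G S o v).verts := Set.mem_insert _ _
  have hS : ∀ x ∈ S, x ∈ (ownedStar G S o v).verts := fun x hx => Set.mem_insert_of_mem _ hx
  have star : ∀ x (hx : x ∈ S), G.Adj x v →
      (ownedStar G S o v).coe.Reachable ⟨x, hS x hx⟩ ⟨v, hv⟩ := fun x hx hxv =>
    Adj.reachable (show (ownedStar G S o v).Adj x v from ⟨hxv, .inr (.inl ⟨hx, rfl⟩)⟩)
  have inner : ∀ x y (hx : x ∈ S) (hy : y ∈ S), G.Adj x y → o s(x, y) = v →
      (ownedStar G S o v).coe.Reachable ⟨x, hS x hx⟩ ⟨y, hS y hy⟩ := fun x y hx hy hxy ho =>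
    Adj.reachable (show (ownedStar G S o v).Adj x y from ⟨hxy, .inr (.inr ⟨hx, hy, ho⟩)⟩)
  rw [connected_iff_exists_forall_reachable]
  refine ⟨⟨v, hv⟩, ?_⟩
  rintro ⟨x, rfl | hx⟩
  · rfl
  · symm
    obtain hxv | ⟨y, hy, hxy, ho, hyv | ⟨z, hz, hyz, ho', hzv⟩⟩ := h x hx
    · exact star x hx hxv
    · exact (inner x y hx hy hxy ho).trans (star y hy hyv)
    · exact ((inner x y hx hy hxy ho).trans (inner y z hy hz hyz ho')).trans (star z hz hzv)

lemma exists_trees_of_ownedReach {V : Type*} [Fintype V] (G : SimpleGraph V) (S : Finset V)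
    (o : Sym2 V → V) (h : ∀ v ∉ S, ∀ x ∈ S, OwnedReach G S o v x) {r : ℕ}
    (hr : r + S.card = Fintype.card V) :
    ∃ T : Fin r → G.Subgraph, IsInternallyDisjointSTrees G (↑S) T := by
  classical
  have hcard : Fintype.card {v // v ∉ S} = r := by
    rw [Fintype.card_subtype_compl, Fintype.card_coe]
    omega
  let e := (Fintype.equivFinOfCardEq hcard).symm
  have key : ∀ i, ∃ T : G.Subgraph, T ≤ ownedStar G S o (e i) ∧
      T.verts = (ownedStar G S o (e i)).verts ∧ T.coe.IsTree := fun i =>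
    Subgraph.exists_isTree_le _ (ownedStar_connected G S o _ (h _ (e i).2))
  choose T hle hverts htree using key
  refine ⟨T, fun i => ⟨?_, htree i⟩, fun i j hij => ⟨?_, ?_⟩⟩
  · rw [hverts]
    exact Set.subset_insert _ _
  · have hne : (e i : V) ≠ e j := fun hc => hij (e.injective (Subtype.ext hc))
    have hi := (e i).2
    have hj := (e j).2
    rw [Set.disjoint_left]
    refine Sym2.ind fun u w hu hw => ?_
    obtain ⟨_, hu⟩ := (hle i).2 hu
    obtain ⟨_, hw⟩ := (hle j).2 hw
    simp only [Finset.mem_coe] at hu hw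
    grind
  · have hne : (e i : V) ≠ e j := fun hc => hij (e.injective (Subtype.ext hc))
    rw [hverts, hverts]
    ext x
    simp only [ownedStar, Set.mem_inter_iff, Set.mem_insert_iff, Finset.mem_coe]
    grind

/-- The number of internally disjoint `S`-trees is at most the degree of a vertex of `S`. -/
lemma IsInternallyDisjointSTrees.le_card {V : Type*} {G : SimpleGraph V} {S : Set V} {r : ℕ}
    {T : Fin r → G.Subgraph} (hT : IsInternallyDisjointSTrees G S T) {x y : V} (hx : x ∈ S)
    (hy : y ∈ S) (hxy : x ≠ y) (N : Finset V) (hN : ∀ w, G.Adj x w → w ∈ N) : r ≤ N.card := by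
  have key : ∀ i, ∃ w, (T i).Adj x w := fun i => by
    have hne : (⟨x, (hT.1 i).1 hx⟩ : (T i).verts) ≠ ⟨y, (hT.1 i).1 hy⟩ := fun hc =>
      hxy (congrArg Subtype.val hc)
    have : Nontrivial (T i).verts := ⟨_, _, hne⟩
    obtain ⟨w, hw⟩ := (hT.1 i).2.1.preconnected.exists_adj_of_nontrivial ⟨x, (hT.1 i).1 hx⟩
    exact ⟨w, hw⟩
  choose w hw using key
  have hinj : Function.Injective w := fun i j hij => by
    by_contra hne
    have hj : s(x, w i) ∈ (T j).edgeSet := hij ▸ hw j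
    exact Set.disjoint_left.1 (hT.2 hne).1 (hw i) hj
  simpa using Finset.card_le_card_of_injOn (s := Finset.univ) w
    (fun i _ => hN _ ((hw i).adj_sub)) hinj.injOn

lemma Finset.exists_eq_of_card_eq_three {α : Type*} [DecidableEq α] {S : Finset α}
    (hS : S.card = 3) {x y : α} (hx : x ∈ S) (hy : y ∈ S) (hxy : x ≠ y) :
    ∃ z, z ≠ x ∧ z ≠ y ∧ S = {x, y, z} := by
  have h1 := Finset.card_erase_of_mem hx
  have h2 := Finset.card_erase_of_mem (Finset.mem_erase.2 ⟨hxy.symm, hy⟩)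
  obtain ⟨z, hz⟩ := Finset.card_eq_one.1 (show ((S.erase x).erase y).card = 1 by omega)
  have hmem : ∀ w, w ∈ (S.erase x).erase y ↔ w = z := fun w => by rw [hz, Finset.mem_singleton]
  simp only [Finset.mem_erase] at hmem
  refine ⟨z, ((hmem z).2 rfl).2.1, ((hmem z).2 rfl).1, ?_⟩
  ext w
  have := hmem w
  simp only [Finset.mem_insert, Finset.mem_singleton]
  grind

lemma exists_ownedReach_delete_p4 {V : Type*} (a b c d : V) (hnd : [a, b, c, d].Nodup)
    (S : Finset V) (hS : S.card = 3) :
    ∃ o : Sym2 V → V, ∀ v ∉ S, ∀ x ∈ S,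
      OwnedReach ((⊤ : SimpleGraph V).deleteEdges {s(a, b), s(b, c), s(c, d)}) S o v x := by
  classical
  obtain ⟨hab, hac, had, hbc, hbd, hcd⟩ :
      a ≠ b ∧ a ≠ c ∧ a ≠ d ∧ b ≠ c ∧ b ≠ d ∧ c ≠ d := by grind
  clear hnd
  simp only [OwnedReach, deleteEdges_adj, top_adj, Set.mem_insert_iff, Set.mem_singleton_iff,
    Sym2.eq_iff, Finset.mem_coe]
  by_cases ha : a ∈ S
  · by_cases hb : b ∈ S
    · by_cases hc : c ∈ S
      · by_cases hd : d ∈ S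
        · have := Finset.card_le_card (show {a, b, c, d} ⊆ S by grind)
          have : ({a, b, c, d} : Finset V).card = 4 := by grind
          omega
        · obtain ⟨z, hz, hz', rfl⟩ := Finset.exists_eq_of_card_eq_three hS ha hb hab
          obtain rfl : z = c := by grind
          refine ⟨fun _ => d, ?_⟩
          simp only [Finset.mem_insert, Finset.mem_singleton, exists_eq_or_imp, exists_eq_left] at *
          grind
      · by_cases hd : d ∈ S
        · obtain ⟨z, hz, hz', rfl⟩ := Finset.exists_eq_of_card_eq_three hS ha hb hab
          obtain rfl : z = d := by grind
          refine ⟨fun _ => c, ?_⟩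
          simp only [Finset.mem_insert, Finset.mem_singleton, exists_eq_or_imp, exists_eq_left] at *
          grind
        · obtain ⟨z, hz, hz', rfl⟩ := Finset.exists_eq_of_card_eq_three hS ha hb hab
          refine ⟨fun _ => c, ?_⟩
          simp only [Finset.mem_insert, Finset.mem_singleton, exists_eq_or_imp, exists_eq_left] at *
          grind
    · by_cases hc : c ∈ S
      · by_cases hd : d ∈ S
        · obtain ⟨z, hz, hz', rfl⟩ := Finset.exists_eq_of_card_eq_three hS ha hc hac
          obtain rfl : z = d := by grind
          refine ⟨fun _ => b, ?_⟩
          simp only [Finset.mem_insert, Finset.mem_singleton, exists_eq_or_imp, exists_eq_left] at *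
          grind
        · obtain ⟨z, hz, hz', rfl⟩ := Finset.exists_eq_of_card_eq_three hS ha hc hac
          refine ⟨fun e => if e = s(a, c) then d else b, ?_⟩
          simp only [Finset.mem_insert, Finset.mem_singleton, Sym2.eq_iff,
            exists_eq_or_imp, exists_eq_left] at *
          grind
      · by_cases hd : d ∈ S
        · obtain ⟨z, hz, hz', rfl⟩ := Finset.exists_eq_of_card_eq_three hS ha hd had
          refine ⟨fun e => if e = s(d, z) then c else b, ?_⟩
          simp only [Finset.mem_insert, Finset.mem_singleton, Sym2.eq_iff,
            exists_eq_or_imp, exists_eq_left] at *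
          grind
        · obtain ⟨y, hy, hyx⟩ := Finset.exists_mem_ne (by omega : 1 < S.card) a
          obtain ⟨z, hz, hz', rfl⟩ := Finset.exists_eq_of_card_eq_three hS ha hy hyx.symm
          refine ⟨fun _ => b, ?_⟩
          simp only [Finset.mem_insert, Finset.mem_singleton, exists_eq_or_imp, exists_eq_left] at *
          grind
  · by_cases hb : b ∈ S
    · by_cases hc : c ∈ S
      · by_cases hd : d ∈ S
        · obtain ⟨z, hz, hz', rfl⟩ := Finset.exists_eq_of_card_eq_three hS hb hc hbc
          obtain rfl : z = d := by grind
          refine ⟨fun _ => a, ?_⟩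
          simp only [Finset.mem_insert, Finset.mem_singleton, exists_eq_or_imp, exists_eq_left] at *
          grind
        · obtain ⟨z, hz, hz', rfl⟩ := Finset.exists_eq_of_card_eq_three hS hb hc hbc
          refine ⟨fun e => if e = s(b, z) then a else d, ?_⟩
          simp only [Finset.mem_insert, Finset.mem_singleton, Sym2.eq_iff,
            exists_eq_or_imp, exists_eq_left] at *
          grind
      · by_cases hd : d ∈ S
        · obtain ⟨z, hz, hz', rfl⟩ := Finset.exists_eq_of_card_eq_three hS hb hd hbd
          refine ⟨fun e => if e = s(b, d) then a else c, ?_⟩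
          simp only [Finset.mem_insert, Finset.mem_singleton, Sym2.eq_iff,
            exists_eq_or_imp, exists_eq_left] at *
          grind
        · obtain ⟨y, hy, hyx⟩ := Finset.exists_mem_ne (by omega : 1 < S.card) b
          obtain ⟨z, hz, hz', rfl⟩ := Finset.exists_eq_of_card_eq_three hS hb hy hyx.symm
          refine ⟨fun e => if e = s(b, y) then a else c, ?_⟩
          simp only [Finset.mem_insert, Finset.mem_singleton, Sym2.eq_iff,
            exists_eq_or_imp, exists_eq_left] at *
          grind
    · by_cases hc : c ∈ S
      · by_cases hd : d ∈ S
        · obtain ⟨z, hz, hz', rfl⟩ := Finset.exists_eq_of_card_eq_three hS hc hd hcd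
          refine ⟨fun _ => b, ?_⟩
          simp only [Finset.mem_insert, Finset.mem_singleton, exists_eq_or_imp, exists_eq_left] at *
          grind
        · obtain ⟨y, hy, hyx⟩ := Finset.exists_mem_ne (by omega : 1 < S.card) c
          obtain ⟨z, hz, hz', rfl⟩ := Finset.exists_eq_of_card_eq_three hS hc hy hyx.symm
          refine ⟨fun e => if e = s(c, y) then d else b, ?_⟩
          simp only [Finset.mem_insert, Finset.mem_singleton, Sym2.eq_iff,
            exists_eq_or_imp, exists_eq_left] at *
          grind
      · by_cases hd : d ∈ S
        · obtain ⟨y, hy, hyx⟩ := Finset.exists_mem_ne (by omega : 1 < S.card) d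
          obtain ⟨z, hz, hz', rfl⟩ := Finset.exists_eq_of_card_eq_three hS hd hy hyx.symm
          refine ⟨fun _ => c, ?_⟩
          simp only [Finset.mem_insert, Finset.mem_singleton, exists_eq_or_imp, exists_eq_left] at *
          grind
        · exact ⟨fun _ => a, by grind⟩

theorem genConn_three_delete_p4 (n : ℕ) (hn : 4 ≤ n) (M : Set (Sym2 (Fin n)))
    (hshape : IsP4Edges M) :
    genConn ((⊤ : SimpleGraph (Fin n)).deleteEdges M) 3 = n - 3 := by
  obtain ⟨a, b, c, d, hnd, rfl⟩ := hshape
  refine IsGreatest.csSup_eq ⟨⟨by omega, fun S hS => ?_⟩, ?_⟩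
  · obtain ⟨o, ho⟩ := exists_ownedReach_delete_p4 a b c d hnd S hS
    exact exists_trees_of_ownedReach _ S o ho (by rw [hS, Fintype.card_fin]; omega)
  · rintro r ⟨-, h⟩
    obtain ⟨hab, hac, hbc⟩ : a ≠ b ∧ a ≠ c ∧ b ≠ c := by grind
    have habc : ({a, b, c} : Finset (Fin n)).card = 3 := Finset.card_eq_three.2
      ⟨a, b, c, hab, hac, hbc, rfl⟩
    obtain ⟨T, hT⟩ := h {a, b, c} habc
    have := hT.le_card (x := b) (y := a) (by simp) (by simp) hab.symm ({a, b, c}ᶜ) (by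
      intro w hw
      rw [deleteEdges_adj, top_adj] at hw
      simp only [Finset.mem_compl, Finset.mem_insert, Finset.mem_singleton]
      rintro (rfl | rfl | rfl)
      · exact hw.2 (by simp [Sym2.eq_swap])
      · exact hw.1 rfl
      · exact hw.2 (by simp))
    rwa [Finset.card_compl, habc, Fintype.card_fin] at this
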